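/- Let G be a non-cyclic finite nilpotent group. Then G satisfies the MGSE property if and only if G is a p-group for some prime p. -/

import Mathlib

/-- A subset `S` of a group is a minimal generating set if it generates the whole
group but no proper subset obtained by removing one element does. -/
def IsMinimalGeneratingSet {G : Type*} [Group G] (S : Set G) : Prop :=
  Subgroup.closure S = ⊤ ∧ ∀ s ∈ S, Subgroup.closure (S \ {s}) ≠ ⊤

/-- `minGen G = d(G)` is the minimal size of a generating set of `G`. -/
noncomputable def minGen (G : Type*) [Group G] : ℕ :=
  sInf {n | ∃ S : Finset G, S.card = n ∧ Subgroup.closure (S : Set G) = ⊤}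

/-- The minimal generating set exchange property (MGSE): whenever
`G = ⟨x_1,…,x_d⟩ = ⟨y_1,…,y_d⟩` with `d = d(G)`, for every `i` there exists `j`
such that replacing `x_i` by `y_j` still yields a generating set. -/
def MGSE (G : Type*) [Group G] : Prop :=
  ∀ x y : Fin (minGen G) → G,
    Subgroup.closure (Set.range x) = ⊤ → Subgroup.closure (Set.range y) = ⊤ →
    ∀ i : Fin (minGen G), ∃ j : Fin (minGen G),
      Subgroup.closure (Set.range (Function.update x i (y j))) = ⊤

open Subgroup

section Generation

variable {G : Type*} [Group G]

/-- A finite generating set has at least `minGen G` elements. -/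
theorem minGen_le_ncard {S : Set G} (hfin : S.Finite) (hS : closure S = ⊤) :
    minGen G ≤ S.ncard := by
  refine Nat.sInf_le ⟨hfin.toFinset, ?_, by simpa using hS⟩
  rw [Set.ncard_eq_toFinset_card S hfin]

/-- A generating tuple has length at least `minGen G`. -/
theorem minGen_le_of_closure_range {n : ℕ} {x : Fin n → G} (hx : closure (Set.range x) = ⊤) :
    minGen G ≤ n := by
  refine (minGen_le_ncard (Set.finite_range x) hx).trans ?_
  rw [← Set.image_univ]
  exact (Set.ncard_image_le Set.finite_univ).trans (by simp)

/-- A finite group has generating tuples of every length at least `minGen G`. -/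
theorem exists_closure_range_eq_top [Finite G] {n : ℕ} (hn : minGen G ≤ n) :
    ∃ x : Fin n → G, closure (Set.range x) = ⊤ := by
  classical
  have hne : {n | ∃ S : Finset G, S.card = n ∧ closure (S : Set G) = ⊤}.Nonempty :=
    ⟨_, (Set.finite_univ (α := G)).toFinset, rfl, by simp⟩
  obtain ⟨S, hcard, hS⟩ := Nat.sInf_mem hne
  change S.card = minGen G at hcard
  refine ⟨fun k => if h : (k : ℕ) < S.card then S.equivFin.symm ⟨k, h⟩ else 1, ?_⟩
  refine top_le_iff.mp (hS ▸ closure_mono fun s hs => ?_)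
  refine ⟨⟨S.equivFin ⟨s, hs⟩, (S.equivFin ⟨s, hs⟩).2.trans_le (hcard ▸ hn)⟩, ?_⟩
  simp

theorem isCyclic_of_minGen_lt_two [Finite G] (h : minGen G < 2) : IsCyclic G := by
  obtain ⟨x, hx⟩ := exists_closure_range_eq_top (G := G) (n := 1) (by omega)
  rw [Set.range_unique, ← zpowers_eq_closure] at hx
  exact isCyclic_iff_exists_zpowers_eq_top.mpr ⟨_, hx⟩

/-- Surjective homomorphisms map generating tuples to generating tuples. -/
theorem closure_range_comp_eq_top {H ι : Type*} [Group H] {f : G →* H}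
    (hf : Function.Surjective f) {x : ι → G} (hx : closure (Set.range x) = ⊤) :
    closure (Set.range (f ∘ x)) = ⊤ := by
  rw [Set.range_comp, ← MonoidHom.map_closure, hx, map_top_of_surjective f hf]

/-- A tuple of length `minGen G` in which one entry repeats another does not generate. -/
theorem closure_range_update_ne_top (x : Fin (minGen G) → G) {i j : Fin (minGen G)}
    (hij : j ≠ i) : closure (Set.range (Function.update x i (x j))) ≠ ⊤ := by
  intro h
  have hsub : Set.range (Function.update x i (x j)) ⊆ x '' {i}ᶜ := by
    rintro _ ⟨k, rfl⟩
    by_cases hk : k = i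
    · subst hk
      exact ⟨j, hij, by simp⟩
    · exact ⟨k, hk, by simp [hk]⟩
  have hle := (minGen_le_ncard (Set.toFinite (x '' {i}ᶜ))
    (top_le_iff.mp (h ▸ closure_mono hsub))).trans (Set.ncard_image_le (Set.toFinite _))
  rw [Set.ncard_compl, Set.ncard_singleton, Nat.card_fin] at hle
  have := i.2
  omega

/-- A nontrivial group with a generating tuple of length `n` has one with an entry that cannot be
deleted. -/
theorem exists_closure_range_update_one_ne_top [Nontrivial G] {n : ℕ}
    (h : ∃ x : Fin n → G, closure (Set.range x) = ⊤) :
    ∃ x : Fin n → G, closure (Set.range x) = ⊤ ∧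
      ∃ i, closure (Set.range (Function.update x i 1)) ≠ ⊤ := by
  classical
  let support (x : Fin n → G) : Finset (Fin n) := Finset.univ.filter fun k => x k ≠ 1
  obtain ⟨x, hx, hmin⟩ := exists_minimalFor_of_wellFoundedLT
    (fun x : Fin n → G => closure (Set.range x) = ⊤) (fun x => (support x).card) h
  refine ⟨x, hx, ?_⟩
  obtain ⟨i, hi⟩ : ∃ i, x i ≠ 1 := by
    by_contra! hone
    have : closure (Set.range x) = ⊥ := by
      rw [closure_eq_bot_iff]
      rintro _ ⟨k, rfl⟩
      exact hone k
    exact bot_ne_top (this.symm.trans hx)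
  refine ⟨i, fun hgen => ?_⟩
  have hlt : (support (Function.update x i 1)).card < (support x).card := by
    refine Finset.card_lt_card (Finset.ssubset_iff_of_subset ?_ |>.mpr ⟨i, ?_, ?_⟩)
    · intro k hk
      by_cases hki : k = i <;> simp_all [support]
    · simpa [support] using hi
    · simp [support]
  exact absurd (hmin hgen hlt.le) (by simpa using hlt)

end Generation

section CoprimeProduct

variable {A B : Type*} [Group A] [Group B]

/-- A subgroup of a direct product of groups of coprime orders is everything as soon as it projects
onto both factors. -/
theorem eq_top_of_map_fst_of_map_snd (hAB : (Nat.card A).Coprime (Nat.card B))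
    {H : Subgroup (A × B)} (hA : H.map (MonoidHom.fst A B) = ⊤)
    (hB : H.map (MonoidHom.snd A B) = ⊤) : H = ⊤ := by
  obtain ⟨m, hmA, hmB⟩ := Nat.chineseRemainder hAB 1 0
  obtain ⟨n, hnA, hnB⟩ := Nat.chineseRemainder hAB 0 1
  refine (eq_top_iff' H).mpr fun ⟨a, b⟩ => ?_
  obtain ⟨⟨a, b'⟩, hb', rfl⟩ : a ∈ H.map (MonoidHom.fst A B) := hA ▸ mem_top a
  obtain ⟨⟨a', b⟩, ha', rfl⟩ : b ∈ H.map (MonoidHom.snd A B) := hB ▸ mem_top b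
  have hmul : ((a, b') ^ m * (a', b) ^ n : A × B) = (a, b) := by
    have h₁ : a ^ m = a ^ 1 := pow_eq_pow_iff_modEq.mpr (hmA.of_dvd (orderOf_dvd_natCard a))
    have h₂ : b' ^ m = b' ^ 0 := pow_eq_pow_iff_modEq.mpr (hmB.of_dvd (orderOf_dvd_natCard b'))
    have h₃ : a' ^ n = a' ^ 0 := pow_eq_pow_iff_modEq.mpr (hnA.of_dvd (orderOf_dvd_natCard a'))
    have h₄ : b ^ n = b ^ 1 := pow_eq_pow_iff_modEq.mpr (hnB.of_dvd (orderOf_dvd_natCard b))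
    rw [Prod.pow_mk, Prod.pow_mk, h₁, h₂, h₃, h₄]
    simp
  have hmem := H.mul_mem (H.pow_mem hb' m) (H.pow_mem ha' n)
  rw [hmul] at hmem
  exact hmem

theorem closure_range_prod_eq_top (hAB : (Nat.card A).Coprime (Nat.card B)) {ι : Type*}
    {a : ι → A} {b : ι → B} (ha : closure (Set.range a) = ⊤) (hb : closure (Set.range b) = ⊤) :
    closure (Set.range fun k => (a k, b k)) = ⊤ := by
  apply eq_top_of_map_fst_of_map_snd hAB
  · rw [MonoidHom.map_closure, ← Set.range_comp]
    exact ha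
  · rw [MonoidHom.map_closure, ← Set.range_comp]
    exact hb

variable {G : Type*} [Group G]

/-- Exchange fails in a noncyclic product of two groups of coprime orders, when the factor needing
fewer generators is nontrivial. -/
theorem not_mgse_of_mulEquiv_prod [Finite G] [Finite A] [Finite B] [Nontrivial B]
    (e : G ≃* A × B) (hAB : (Nat.card A).Coprime (Nat.card B)) (hle : minGen B ≤ minGen A)
    (hnc : ¬ IsCyclic G) : ¬ MGSE G := by
  have htwo : 2 ≤ minGen G := by
    by_contra! h
    exact hnc (isCyclic_of_minGen_lt_two h)
  have hfst : Function.Surjective ((MonoidHom.fst A B).comp e.toMonoidHom) :=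
    Prod.fst_surjective.comp e.surjective
  have hsnd : Function.Surjective ((MonoidHom.snd A B).comp e.toMonoidHom) :=
    Prod.snd_surjective.comp e.surjective
  have hsymm {ι : Type} {a : ι → A} {b : ι → B} (ha : closure (Set.range a) = ⊤)
      (hb : closure (Set.range b) = ⊤) : closure (Set.range fun k => e.symm (a k, b k)) = ⊤ :=
    closure_range_comp_eq_top (f := e.symm.toMonoidHom) e.symm.surjective
      (closure_range_prod_eq_top hAB ha hb)
  have hd : minGen G = minGen A := by
    apply le_antisymm
    · obtain ⟨a, ha⟩ := exists_closure_range_eq_top (le_refl (minGen A))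
      obtain ⟨b, hb⟩ := exists_closure_range_eq_top hle
      exact minGen_le_of_closure_range (hsymm ha hb)
    · obtain ⟨x, hx⟩ := exists_closure_range_eq_top (le_refl (minGen G))
      exact minGen_le_of_closure_range (closure_range_comp_eq_top hfst hx)
  unfold MGSE
  rw [hd] at htwo ⊢
  obtain ⟨a, ha⟩ := exists_closure_range_eq_top (le_refl (minGen A))
  obtain ⟨b, hb, i, hi⟩ := exists_closure_range_update_one_ne_top (exists_closure_range_eq_top hle)
  have : Nontrivial (Fin (minGen A)) := Fin.nontrivial_iff_two_le.mpr htwo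
  obtain ⟨l, hl⟩ := exists_ne i
  intro hex
  have hswap : closure (Set.range (b ∘ Equiv.swap i l)) = ⊤ := by
    rwa [(Equiv.swap i l).surjective.range_comp]
  obtain ⟨j, hj⟩ := hex _ _ (hsymm ha hb) (hsymm ha hswap) i
  have hjA := closure_range_comp_eq_top hfst hj
  have hjB := closure_range_comp_eq_top hsnd hj
  simp only [Function.comp_update] at hjA hjB
  have hji : j = i := by
    by_contra hne
    refine closure_range_update_ne_top a hne ?_
    simpa [Function.comp_def] using hjA
  subst hji
  replace hjB : closure (Set.range (Function.update b j (b l))) = ⊤ := by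
    simpa [Function.comp_def] using hjB
  refine hi (top_le_iff.mp (hjB ▸ closure_mono ?_))
  rintro _ ⟨k, rfl⟩
  by_cases hk : k = j
  · subst hk
    exact ⟨l, by simp [hl]⟩
  · exact ⟨k, by simp [hk]⟩

end CoprimeProduct

section Nilpotent

variable {G : Type*} [Group G]

/-- Exchange fails in a noncyclic finite nilpotent group which is not a `p`-group. -/
theorem not_mgse_of_isNilpotent [Finite G] (hnc : ¬ IsCyclic G) (hnil : Group.IsNilpotent G)
    (hp : ¬ ∃ p : ℕ, p.Prime ∧ IsPGroup p G) : ¬ MGSE G := by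
  classical
  push Not at hp
  obtain ⟨e⟩ := (Group.isNilpotent_of_finite_tfae (G := G)).out 0 4 |>.mp hnil
  have hprime (q : (Nat.card G).primeFactors) : Fact (q : ℕ).Prime :=
    ⟨Nat.prime_of_mem_primeFactors q.2⟩
  let F (q : (Nat.card G).primeFactors) : Type _ := ∀ P : Sylow q G, (P : Subgroup G)
  have hnontriv (q : (Nat.card G).primeFactors) : Nontrivial (F q) := by
    have (P : Sylow q G) : Nontrivial (P : Subgroup G) :=
      (nontrivial_iff_ne_bot _).mpr (P.ne_bot_of_dvd_card (Nat.dvd_of_mem_primeFactors q.2))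
    exact Pi.nontrivial
  have hG : Nat.card G ≠ 1 := fun h =>
    have := (Nat.card_eq_one_iff_unique.mp h).1
    hnc inferInstance
  obtain ⟨p, hpp, hpdvd⟩ := Nat.exists_prime_and_dvd hG
  let p' : (Nat.card G).primeFactors := ⟨p, by simp [hpp, hpdvd, Nat.card_pos.ne']⟩
  obtain ⟨q, hq, hqp⟩ : ∃ q ∈ (Nat.card G).primeFactors, q ≠ p := by
    have := (isPGroup_iff_primeFactors_card_subset hpp.ne_zero).not.mp (hp p hpp)
    rw [hpp.primeFactors, Finset.not_subset] at this
    simpa only [Finset.mem_singleton] using this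
  let A := ∀ r : {r // r = p'}, F r
  let B := ∀ r : {r // ¬ r = p'}, F r
  have : Nontrivial A := Pi.nontrivial_at ⟨p', rfl⟩
  have : Nontrivial B := Pi.nontrivial_at ⟨⟨q, hq⟩, fun h => hqp (congrArg Subtype.val h)⟩
  have hAB : (Nat.card A).Coprime (Nat.card B) := by
    rw [Nat.card_pi, Nat.card_pi]
    refine Nat.Coprime.prod_left fun r _ => Nat.Coprime.prod_right fun s _ => ?_
    have := Fintype.ofFinite (Sylow r G)
    have := Fintype.ofFinite (Sylow s G)
    rw [Nat.card_pi, Nat.card_pi]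
    refine Nat.Coprime.prod_left fun P _ => Nat.Coprime.prod_right fun Q _ =>
      IsPGroup.coprime_card_of_ne r s (fun h => s.2 ?_) _ _ P.isPGroup' Q.isPGroup'
    exact (Subtype.ext h.symm).trans r.2
  let split : (∀ r, F r) ≃* A × B :=
    { Equiv.piEquivPiSubtypeProd (fun r => r = p') F with map_mul' := fun _ _ => rfl }
  let f : G ≃* A × B := e.symm.trans split
  rcases le_total (minGen B) (minGen A) with h | h
  · exact not_mgse_of_mulEquiv_prod f hAB h hnc
  · exact not_mgse_of_mulEquiv_prod (f.trans MulEquiv.prodComm) hAB.symm h hnc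

/-- If two coprime powers of `x` lie in `H`, then so does `x`. -/
theorem Subgroup.mem_of_zpow_mem_of_isCoprime {H : Subgroup G} {x : G} {k l : ℤ}
    (hkl : IsCoprime k l) (hk : x ^ k ∈ H) (hl : x ^ l ∈ H) : x ∈ H := by
  obtain ⟨u, v, h⟩ := hkl
  have := H.mul_mem (H.zpow_mem hk u) (H.zpow_mem hl v)
  rwa [← zpow_mul, ← zpow_mul, ← zpow_add, mul_comm k, mul_comm l, h, zpow_one] at this

/-- Maximal normal subgroups of a `p`-group contain all `p`-th powers. -/
theorem IsPGroup.pow_mem_of_isCoatom {p : ℕ} (hG : IsPGroup p G) {M : Subgroup G} [M.Normal]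
    (hM : IsCoatom M) (x : G) : x ^ p ∈ M := by
  by_contra hx
  have htop : M ⊔ zpowers (x ^ p) = ⊤ := hM.2 _ (left_lt_sup.mpr fun h => hx (h (mem_zpowers _)))
  obtain ⟨m, hm, _, ⟨k, rfl⟩, hmul⟩ := mem_sup_of_normal_left.mp (htop ▸ mem_top x)
  obtain ⟨n, hn⟩ := hG x
  have hmem : x ^ (1 - p * k : ℤ) ∈ M := by
    rw [zpow_sub, zpow_one, zpow_mul, zpow_natCast]
    rwa [← eq_mul_inv_of_mul_eq hmul]
  have hcop : IsCoprime (1 - p * k : ℤ) (p ^ n : ℤ) :=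
    IsCoprime.pow_right ⟨1, k, by ring⟩
  refine hx (M.pow_mem (mem_of_zpow_mem_of_isCoprime hcop hmem ?_) p)
  have : x ^ (p ^ n : ℤ) = 1 := by exact_mod_cast hn
  rw [this]
  exact M.one_mem

/-- In a `p`-group, a subgroup that generates the group together with a single element lies in at
most one maximal normal subgroup. -/
theorem IsPGroup.le_of_isCoatom {p : ℕ} (hp : p.Prime) (hG : IsPGroup p G) {H M N : Subgroup G}
    [M.Normal] [N.Normal] (hM : IsCoatom M) (hN : IsCoatom N) (hHM : H ≤ M) (hHN : H ≤ N) {x : G}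
    (hx : H ⊔ zpowers x = ⊤) : M ≤ N := by
  intro g hg
  have htop : (M ⊓ N) ⊔ zpowers x = ⊤ :=
    top_le_iff.mp (hx ▸ sup_le_sup_right (le_inf hHM hHN) _)
  obtain ⟨m, hm, _, ⟨k, rfl⟩, rfl⟩ := mem_sup_of_normal_left.mp (htop ▸ mem_top g)
  have hk : x ^ k ∈ M := (M.mul_mem_cancel_left hm.1).mp hg
  refine N.mul_mem hm.2 ?_
  by_cases hpk : (p : ℤ) ∣ k
  · obtain ⟨c, rfl⟩ := hpk
    change x ^ (p * c : ℤ) ∈ N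
    rw [zpow_mul, zpow_natCast]
    exact N.zpow_mem (hG.pow_mem_of_isCoatom hN x) c
  · have hcop : IsCoprime (p : ℤ) k := ((Nat.prime_iff_prime_int.mp hp).coprime_iff_not_dvd).mpr hpk
    have hxM : x ∈ M := mem_of_zpow_mem_of_isCoprime hcop
      (by rw [zpow_natCast]; exact hG.pow_mem_of_isCoatom hM x) hk
    exact absurd (top_le_iff.mp (hx ▸ sup_le hHM (zpowers_le.mpr hxM))) hM.1

/-- Exchange holds in finite `p`-groups. -/
theorem IsPGroup.mgse [Finite G] {p : ℕ} (hp : p.Prime) (hG : IsPGroup p G) : MGSE G := by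
  have : Fact p.Prime := ⟨hp⟩
  have hnormal {M : Subgroup G} (hM : IsCoatom M) : M.Normal :=
    have := hG.isNilpotent
    Group.normalizerCondition_of_isNilpotent.normal_of_coatom M hM
  intro x y hx hy i
  by_contra! hne
  let H := closure (x '' {i}ᶜ)
  have hHx : H ⊔ zpowers (x i) = ⊤ := by
    rw [zpowers_eq_closure, ← Subgroup.closure_union, ← top_le_iff, ← hx]
    refine closure_mono ?_
    rintro _ ⟨k, rfl⟩
    by_cases hk : k = i
    · exact Or.inr (by simp [hk])
    · exact Or.inl ⟨k, hk, rfl⟩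
  have hHj (j : Fin (minGen G)) : ∃ M : Subgroup G, IsCoatom M ∧ H ≤ M ∧ y j ∈ M := by
    obtain ⟨M, hM, hle⟩ := (eq_top_or_exists_le_coatom _).resolve_left (hne j)
    refine ⟨M, hM, (Subgroup.closure_mono ?_).trans hle,
      hle (subset_closure ⟨i, Function.update_self ..⟩)⟩
    rintro _ ⟨k, hk, rfl⟩
    exact ⟨k, Function.update_of_ne hk _ _⟩
  obtain ⟨M, hM, hHM, -⟩ := hHj i
  have := hnormal hM
  refine hM.1 (top_le_iff.mp (hy ▸ (closure_le M).mpr ?_))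
  rintro _ ⟨j, rfl⟩
  obtain ⟨N, hN, hHN, hyN⟩ := hHj j
  have := hnormal hN
  exact hG.le_of_isCoatom hp hN hM hHN hHM hHx hyN

end Nilpotent

/-- A non-cyclic finite nilpotent group satisfies the MGSE property if and only if it
is a `p`-group for some prime `p`. -/
theorem mgse_iff_isPGroup_of_nilpotent {G : Type*} [Group G] [Finite G]
    (hnc : ¬ IsCyclic G) (hnil : Group.IsNilpotent G) :
    MGSE G ↔ ∃ p : ℕ, p.Prime ∧ IsPGroup p G := by
  refine ⟨fun h => ?_, fun ⟨p, hp, hG⟩ => hG.mgse hp⟩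
  by_contra hp
  exact not_mgse_of_isNilpotent hnc hnil hp h
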